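/- Let K be a field, let R be a commutative local K-algebra, and let D : R → R be a K-linear derivation that is 'singular' in the sense that D(x) lies in the maximal ideal of R for every x ∈ R. Let a ∈ R be a regular element (i.e., not a zero divisor), let W and V be units of R, and let c_0, c ∈ K be scalars such that the images of c_0 and c in R satisfy: (i) c_0 − c maps to a unit of R whenever c_0 ≠ c (e.g., R is a local K-algebra whose structure map sends nonzero elements of K to units), (ii) D(a·W) = c_0 · (a·W) and (iii) D(a·V) = c · (a·V). Then c_0 = c. -/

import Mathlib

/-- Eigenvalue separation: if a singular derivation (all values in the maximal
ideal) has `a·W` and `a·V` as eigenvectors, with `a` regular and `W`, `V` units,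
then the two eigenvalues coincide. -/
theorem eigenvalue_separation {K : Type*} [Field K] {R : Type*} [CommRing R]
    [IsLocalRing R] [Algebra K R] (D : Derivation K R R)
    (hsing : ∀ x : R, D x ∈ IsLocalRing.maximalIdeal R)
    (a : R) (ha : a ∈ nonZeroDivisors R) (W V : Rˣ) (c₀ c : K)
    (hunit : c₀ ≠ c → IsUnit (algebraMap K R (c₀ - c)))
    (hW : D (a * W) = algebraMap K R c₀ * (a * W))
    (hV : D (a * V) = algebraMap K R c * (a * V)) :
    c₀ = c := by
  by_contra hne
  have hu := hunit hne
  have key : algebraMap K R (c₀ - c) * (W * V) = V * D W - W * D V := by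
    rw [Derivation.leibniz, smul_eq_mul, smul_eq_mul] at hW hV
    have h : (algebraMap K R (c₀ - c) * (W * V) - (V * D W - W * D V)) * a = 0 := by
      rw [map_sub]
      linear_combination (W : R) * hV - (V : R) * hW
    exact sub_eq_zero.mp ((mem_nonZeroDivisors_iff_right.mp ha) _ h)
  have hm : algebraMap K R (c₀ - c) * (W * V) ∈ IsLocalRing.maximalIdeal R := by
    rw [key]
    exact Ideal.sub_mem _ (Ideal.mul_mem_left _ _ (hsing _)) (Ideal.mul_mem_left _ _ (hsing _))
  exact (IsLocalRing.mem_maximalIdeal _).mp hm (hu.mul (W.isUnit.mul V.isUnit))
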